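/- arXiv:1603.07243 — 2 statements merged into one kernel-verified Lean document; each statement's English description precedes it below -/
import Mathlib

section
/- Let G be a finite simple graph, k a positive integer, and e an edge of G. Then γ_{P,k}(G − e) ≥ γ_{P,k}(G) − 1, where G − e is the graph obtained from G by removing the edge e. -/
open SimpleGraph

variable {V : Type*}

/-- The closed neighbourhood `N_G[v]` of a vertex. -/
def closedNbhd (G : SimpleGraph V) (v : V) : Set V := insert v (G.neighborSet v)

/-- The closed neighbourhood `N_G[X]` of a set of vertices. -/
def closedNbhdSet (G : SimpleGraph V) (X : Set V) : Set V := ⋃ v ∈ X, closedNbhd G v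

/-- The sets `P^i_{G,k}(S)` of vertices monitored by `S` at step `i`. -/
def monitored (G : SimpleGraph V) (k : ℕ) (S : Set V) : ℕ → Set V
  | 0 => closedNbhdSet G S
  | i + 1 =>
      ⋃ v ∈ {w | w ∈ monitored G k S i ∧ (closedNbhd G w \ monitored G k S i).ncard ≤ k},
        closedNbhd G v

/-- `S` is a `k`-power dominating set of `G`. -/
def IsPDS (G : SimpleGraph V) (k : ℕ) (S : Set V) : Prop :=
  ∃ i, monitored G k S i = Set.univ

/-- The `k`-power domination number `γ_{P,k}(G)`. -/
noncomputable def pdn (G : SimpleGraph V) (k : ℕ) : ℕ :=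
  sInf {n | ∃ S : Set V, IsPDS G k S ∧ S.ncard = n}

/-- The radius `rad_{P,k}(G,S)` of a `k`-PDS `S`. -/
noncomputable def radPDS (G : SimpleGraph V) (k : ℕ) (S : Set V) : ℕ :=
  1 + sInf {i | monitored G k S i = Set.univ}

/-- The `k`-propagation radius `rad_{P,k}(G)`. -/
noncomputable def propRad (G : SimpleGraph V) (k : ℕ) : ℕ :=
  sInf {r | ∃ S : Set V, IsPDS G k S ∧ S.ncard = pdn G k ∧ radPDS G k S = r}

theorem closedNbhd_subset_monitored_insert (G : SimpleGraph V) (k : ℕ) (S : Set V) (u : V)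
    (i : ℕ) : closedNbhd G u ⊆ monitored G k (insert u S) i := by
  induction i with
  | zero => exact Set.subset_biUnion_of_mem (u := closedNbhd G) (Set.mem_insert u S)
  | succ i ih =>
    refine Set.subset_biUnion_of_mem (u := closedNbhd G) ⟨ih (Set.mem_insert _ _), ?_⟩
    simp [Set.sdiff_eq_empty.mpr ih]

theorem closedNbhd_mono {G H : SimpleGraph V} (h : H ≤ G) (v : V) :
    closedNbhd H v ⊆ closedNbhd G v :=
  Set.insert_subset_insert fun _ hw => h hw

/-- Removing an edge `uv` monitors no more than keeping it and adding `u` to the initial set. -/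
theorem monitored_deleteEdges_subset [Finite V] {G : SimpleGraph V} (k : ℕ) (S : Set V) {u v : V}
    (huv : G.Adj u v) (i : ℕ) :
    monitored (G.deleteEdges {s(u, v)}) k S i ⊆ monitored G k (insert u S) i := by
  have hle : G.deleteEdges {s(u, v)} ≤ G := G.deleteEdges_le _
  induction i with
  | zero => exact Set.biUnion_mono (Set.subset_insert u S) fun w _ => closedNbhd_mono hle w
  | succ i ih =>
    refine Set.biUnion_mono ?_ fun w _ => closedNbhd_mono hle w
    rintro w ⟨hw, hcard⟩
    refine ⟨ih hw, (Set.ncard_le_ncard ?_).trans hcard⟩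
    rintro x ⟨hx, hxP⟩
    have hN := closedNbhd_subset_monitored_insert G k S u i
    have hxu : x ≠ u := by rintro rfl; exact hxP (hN (Set.mem_insert _ _))
    have hxv : x ≠ v := by rintro rfl; exact hxP (hN (Set.mem_insert_of_mem _ huv))
    refine ⟨?_, fun h => hxP (ih h)⟩
    rcases hx with rfl | hx
    · exact Set.mem_insert _ _
    · refine Set.mem_insert_of_mem _ ?_
      have hx' : G.Adj w x := hx
      simp [hx', hxu, hxv]

theorem isPDS_univ (G : SimpleGraph V) (k : ℕ) : IsPDS G k Set.univ :=
  ⟨0, Set.eq_univ_of_forall fun v => Set.mem_biUnion (Set.mem_univ v) (Set.mem_insert v _)⟩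

theorem exists_isPDS_ncard_eq_pdn (G : SimpleGraph V) (k : ℕ) :
    ∃ S : Set V, IsPDS G k S ∧ S.ncard = pdn G k :=
  Nat.sInf_mem (s := {n | ∃ S : Set V, IsPDS G k S ∧ S.ncard = n}) ⟨_, _, isPDS_univ G k, rfl⟩

theorem IsPDS.pdn_le_ncard {G : SimpleGraph V} {k : ℕ} {S : Set V} (h : IsPDS G k S) :
    pdn G k ≤ S.ncard :=
  Nat.sInf_le ⟨S, h, rfl⟩

theorem pdn_edge_deletion_lower {V : Type*} [Fintype V]
    (G : SimpleGraph V) (k : ℕ) (hk : 0 < k) (e : Sym2 V) (he : e ∈ G.edgeSet) :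
    pdn G k ≤ pdn (G.deleteEdges {e}) k + 1 := by
  induction e with
  | h u v =>
    obtain ⟨S, ⟨i, hi⟩, hS⟩ := exists_isPDS_ncard_eq_pdn (G.deleteEdges {s(u, v)}) k
    have hPDS : IsPDS G k (insert u S) :=
      ⟨i, Set.univ_subset_iff.mp (hi ▸ monitored_deleteEdges_subset k S he i)⟩
    rw [← hS]
    exact hPDS.pdn_le_ncard.trans (Set.ncard_insert_le u S)
end

section
/- Let k be a positive integer, a ≥ k + 2, and G = K_a □ K_a the Cartesian product of two complete graphs on a vertices. Then γ_{P,k}(G − e) = a − k − 1 for every edge e of G, where G − e is the graph obtained from G by removing the edge e. -/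
open SimpleGraph

variable {V : Type*}

theorem mem_closedNbhd {G : SimpleGraph V} {v w : V} :
    w ∈ closedNbhd G v ↔ w = v ∨ G.Adj v w := Iff.rfl

theorem mem_closedNbhdSet {G : SimpleGraph V} {X : Set V} {w : V} :
    w ∈ closedNbhdSet G X ↔ ∃ v ∈ X, w ∈ closedNbhd G v := by
  simp [closedNbhdSet]

theorem mem_monitored_succ {G : SimpleGraph V} {k : ℕ} {S : Set V} {i : ℕ} {w : V} :
    w ∈ monitored G k S (i + 1) ↔ ∃ v ∈ monitored G k S i,
      (closedNbhd G v \ monitored G k S i).ncard ≤ k ∧ w ∈ closedNbhd G v := by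
  simp [monitored, and_assoc]

theorem mem_monitored_succ_of_closedNbhd_subset {G : SimpleGraph V} {k : ℕ} {S : Set V} {i : ℕ}
    {v w : V} (h : closedNbhd G v ⊆ monitored G k S i) (hw : w ∈ closedNbhd G v) :
    w ∈ monitored G k S (i + 1) := by
  refine mem_monitored_succ.2 ⟨v, h (Or.inl rfl), ?_, hw⟩
  simp [Set.sdiff_eq_empty.2 h]

theorem monotone_monitored (G : SimpleGraph V) (k : ℕ) (S : Set V) :
    Monotone (monitored G k S) := by
  refine monotone_nat_of_le_succ fun i w hw => ?_
  cases i with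
  | zero =>
    obtain ⟨v, hv, hvw⟩ := mem_closedNbhdSet.1 hw
    exact mem_monitored_succ_of_closedNbhd_subset
      (fun u hu => mem_closedNbhdSet.2 ⟨v, hv, hu⟩) hvw
  | succ i =>
    obtain ⟨v, hv, hk, hvw⟩ := mem_monitored_succ.1 hw
    exact mem_monitored_succ_of_closedNbhd_subset
      (fun u hu => mem_monitored_succ.2 ⟨v, hv, hk, hu⟩) hvw

/-- `M` is closed under the `k`-propagation rule. -/
def IsPropagationClosed (G : SimpleGraph V) (k : ℕ) (M : Set V) : Prop :=
  ∀ v ∈ M, (closedNbhd G v \ M).ncard ≤ k → closedNbhd G v ⊆ M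

theorem monitored_subset_of_isPropagationClosed {G : SimpleGraph V} {k : ℕ} {S M : Set V}
    (hS : closedNbhdSet G S ⊆ M)
    (hM : ∀ v ∈ M, ¬ closedNbhd G v ⊆ M → ∀ T ⊆ M, k < (closedNbhd G v \ T).ncard) (i : ℕ) :
    monitored G k S i ⊆ M := by
  induction i with
  | zero => exact hS
  | succ i ih =>
    intro w hw
    obtain ⟨v, hv, hk, hvw⟩ := mem_monitored_succ.1 hw
    by_contra hwM
    exact (hM v (ih hv) (fun h => hwM (h hvw)) _ ih).not_ge hk

theorem isPDS_of_forall_isPropagationClosed [Finite V] {G : SimpleGraph V} {k : ℕ} {S : Set V}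
    (h : ∀ M, closedNbhdSet G S ⊆ M → IsPropagationClosed G k M → M = Set.univ) :
    IsPDS G k S := by
  obtain ⟨n, hn⟩ := WellFoundedGT.monotone_chain_condition
    (⟨monitored G k S, monotone_monitored G k S⟩ : ℕ →o Set V)
  refine ⟨n, h _ (monotone_monitored G k S (Nat.zero_le n)) fun v hv hk w hw => ?_⟩
  have hn' : monitored G k S n = monitored G k S (n + 1) := hn (n + 1) n.le_succ
  rw [hn']
  exact mem_monitored_succ.2 ⟨v, hv, hk, hw⟩

section Iso

variable {W : Type*} {G : SimpleGraph V} {H : SimpleGraph W}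

theorem closedNbhd_iso (f : G ≃g H) (v : V) : closedNbhd H (f v) = f '' closedNbhd G v := by
  ext w
  obtain ⟨w, rfl⟩ := f.surjective w
  simp [mem_closedNbhd, SimpleGraph.Iso.map_adj_iff f]

theorem monitored_iso (f : G ≃g H) (k : ℕ) (S : Set V) (i : ℕ) :
    monitored H k (f '' S) i = f '' monitored G k S i := by
  induction i with
  | zero =>
    simp [monitored, closedNbhdSet, closedNbhd_iso, Set.image_iUnion]
  | succ i ih =>
    ext w
    obtain ⟨w, rfl⟩ := f.surjective w
    simp only [mem_monitored_succ, ih, Set.exists_mem_image, closedNbhd_iso,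
      ← Set.image_sdiff f.injective, Set.ncard_image_of_injective _ f.injective,
      f.injective.mem_set_image]

theorem IsPDS.image_iso {k : ℕ} {S : Set V} (h : IsPDS G k S) (f : G ≃g H) :
    IsPDS H k (f '' S) := by
  obtain ⟨i, hi⟩ := h
  exact ⟨i, by rw [monitored_iso, hi, Set.image_univ, f.surjective.range_eq]⟩

end Iso

theorem ncard_le_ncard_inter_closedNbhd_deleteEdges [Finite V] {G : SimpleGraph V} (e : Sym2 V)
    {v : V} {T : Set V} (hT : T ⊆ G.neighborSet v) :
    T.ncard ≤ (T ∩ closedNbhd (G.deleteEdges {e}) v).ncard + 1 := by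
  rw [← Set.ncard_inter_add_ncard_sdiff_eq_ncard T (closedNbhd (G.deleteEdges {e}) v)]
  gcongr
  rw [Set.ncard_le_one]
  have key : ∀ w ∈ T \ closedNbhd (G.deleteEdges {e}) v, s(v, w) = e := by
    rintro w ⟨hw, hn⟩
    by_contra hne
    exact hn (Or.inr (deleteEdges_adj.2 ⟨hT hw, hne⟩))
  intro w hw u hu
  exact Sym2.congr_right.1 ((key w hw).trans (key u hu).symm)

section RookGraph

variable {α β : Type*} {k : ℕ}

theorem monitored_boxProd_top_deleteEdges_disjoint [Finite α] [Finite β] (e : Sym2 (α × β))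
    {S : Set (α × β)} {A : Set α} {B : Set β} (hA : k + 2 ≤ A.ncard) (hB : k + 2 ≤ B.ncard)
    (hSA : ∀ p ∈ S, p.1 ∉ A) (hSB : ∀ p ∈ S, p.2 ∉ B) (i : ℕ) :
    monitored (((⊤ : SimpleGraph α) □ (⊤ : SimpleGraph β)).deleteEdges {e}) k S i ⊆
      (A ×ˢ B)ᶜ := by
  refine monitored_subset_of_isPropagationClosed ?_ ?_ i
  · rintro ⟨x, y⟩ h ⟨hx, hy⟩
    obtain ⟨⟨x', y'⟩, hS, h⟩ := mem_closedNbhdSet.1 h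
    have h1 := hSA _ hS
    have h2 := hSB _ hS
    simp only [mem_closedNbhd, deleteEdges_adj, boxProd_adj, Prod.mk.injEq] at *
    grind
  · rintro ⟨x, y⟩ hv hN T hT
    have bound : ∀ U ⊆ A ×ˢ B,
        U ⊆ ((⊤ : SimpleGraph α) □ (⊤ : SimpleGraph β)).neighborSet (x, y) →
        k + 2 ≤ U.ncard →
        k < (closedNbhd (((⊤ : SimpleGraph α) □ ⊤).deleteEdges {e}) (x, y) \ T).ncard := by
      intro U hU hUN hk
      have h1 := ncard_le_ncard_inter_closedNbhd_deleteEdges e hUN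
      have h2 := Set.ncard_le_ncard (s := U ∩ closedNbhd (((⊤ : SimpleGraph α) □ ⊤).deleteEdges {e})
        (x, y)) (t := closedNbhd (((⊤ : SimpleGraph α) □ ⊤).deleteEdges {e}) (x, y) \ T)
        (fun w hw => ⟨hw.2, fun hwT => hT hwT (hU hw.1)⟩)
      omega
    simp only [Set.mem_compl_iff, Set.mem_prod] at hv
    by_cases hx : x ∈ A
    · have hy : y ∉ B := fun hy => hv ⟨hx, hy⟩
      refine bound (Prod.mk x '' B) ?_ ?_ ?_
      · rintro _ ⟨b, hb, rfl⟩
        exact ⟨hx, hb⟩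
      · rintro _ ⟨b, hb, rfl⟩
        simp only [mem_neighborSet, boxProd_adj, top_adj]
        grind
      · rwa [Set.ncard_image_of_injective _ (Prod.mk_right_injective x)]
    · by_cases hy : y ∈ B
      · refine bound ((fun b => (b, y)) '' A) ?_ ?_ ?_
        · rintro _ ⟨b, hb, rfl⟩
          exact ⟨hb, hy⟩
        · rintro _ ⟨b, hb, rfl⟩
          simp only [mem_neighborSet, boxProd_adj, top_adj]
          grind
        · rwa [Set.ncard_image_of_injective _ (Prod.mk_left_injective y)]
      · refine absurd ?_ hN
        rintro ⟨x', y'⟩ h ⟨hx', hy'⟩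
        simp only [mem_closedNbhd, deleteEdges_adj, boxProd_adj, Prod.mk.injEq] at *
        grind

theorem IsPDS.le_ncard_boxProd_top_deleteEdges {a : ℕ} (ha : k + 2 ≤ a)
    (e : Sym2 (Fin a × Fin a)) {S : Set (Fin a × Fin a)}
    (hS : IsPDS (((⊤ : SimpleGraph (Fin a)) □ (⊤ : SimpleGraph (Fin a))).deleteEdges {e}) k S) :
    a - k - 1 ≤ S.ncard := by
  by_contra! hlt
  obtain ⟨i, hi⟩ := hS
  have large : ∀ f : Fin a × Fin a → Fin a, k + 2 ≤ (f '' S)ᶜ.ncard := fun f => by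
    have h1 := Set.ncard_image_le (f := f) S.toFinite
    have h2 := Set.ncard_add_ncard_compl (f '' S)
    rw [Nat.card_fin] at h2
    omega
  have hsub := monitored_boxProd_top_deleteEdges_disjoint e (large Prod.fst) (large Prod.snd)
    (fun p hp h => h ⟨p, hp, rfl⟩) (fun p hp h => h ⟨p, hp, rfl⟩) i
  obtain ⟨x, hx⟩ := Set.nonempty_of_ncard_ne_zero (Nat.ne_zero_of_lt (large Prod.fst))
  obtain ⟨y, hy⟩ := Set.nonempty_of_ncard_ne_zero (Nat.ne_zero_of_lt (large Prod.snd))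
  exact hsub (hi ▸ Set.mem_univ (x, y)) ⟨hx, hy⟩

theorem isPDS_graph_boxProd_top_deleteEdges [Fintype α] [DecidableEq α] (hk : 0 < k)
    {x x' y : α} {R : Finset α} (σ : Equiv.Perm α) (hx : x ∈ R) (hx' : x' ∉ R) (hσ : σ x' = y)
    (hR : R.card + (k + 1) = Fintype.card α) :
    IsPDS (((⊤ : SimpleGraph α) □ (⊤ : SimpleGraph α)).deleteEdges {s((x, y), (x', y))}) k
      ((fun i => (i, σ i)) '' (R : Set α)) := by
  refine isPDS_of_forall_isPropagationClosed fun M hS hM => ?_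
  set G := ((⊤ : SimpleGraph α) □ (⊤ : SimpleGraph α)).deleteEdges {s((x, y), (x', y))} with hG
  have mem_nbhd : ∀ i j i' j', (i', j') ∈ closedNbhd G (i, j) ↔ (i' = i ∧ j' = j) ∨
      ((i ≠ i' ∧ j = j' ∨ j ≠ j' ∧ i = i') ∧
        ¬ (((i = x ∧ j = y) ∧ i' = x' ∧ j' = y) ∨ (i = x' ∧ j = y) ∧ i' = x ∧ j' = y)) := by
    intro i j i' j'
    simp [hG, mem_closedNbhd, boxProd_adj]
  have hxx' : x ≠ x' := fun h => hx' (h ▸ hx)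
  have force : ∀ v ∈ M, ∀ T : Finset (α × α), closedNbhd G v \ M ⊆ T → T.card ≤ k →
      closedNbhd G v ⊆ M := fun v hv T hT hTk => hM v hv <| by
    have := Set.ncard_le_ncard hT
    rw [Set.ncard_coe_finset] at this
    omega
  have hD : (Rᶜ.erase x').card = k := by
    rw [Finset.card_erase_of_mem (by simpa using hx'), Finset.card_compl]
    omega
  have rows : ∀ i ∈ R, ∀ j, (i, j) ∈ M := fun i hi j =>
    hS (mem_closedNbhdSet.2 ⟨(i, σ i), ⟨i, hi, rfl⟩, (mem_nbhd _ _ _ _).2 (by grind)⟩)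
  have cols : ∀ i, ∀ j ∈ R, (i, σ j) ∈ M := fun i j hj =>
    hS (mem_closedNbhdSet.2 ⟨(j, σ j), ⟨j, hj, rfl⟩, (mem_nbhd _ _ _ _).2 (by
      have := σ.injective.eq_iff (a := j) (b := x')
      grind)⟩)
  have column_y : ∀ i, i ≠ x' → (i, y) ∈ M := by
    intro i hi
    refine force (x, y) (rows x hx y) ((Rᶜ.erase x').image fun i => (i, y)) ?_
      (Finset.card_image_le.trans hD.le) ((mem_nbhd _ _ _ _).2 (by grind))
    rintro ⟨i', j'⟩ ⟨hN, hnM⟩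
    rw [mem_nbhd] at hN
    have := rows i'
    have := rows x hx j'
    simp only [Finset.coe_image, Set.mem_image, Finset.mem_coe, Finset.mem_erase,
      Finset.mem_compl, Prod.mk.injEq]
    grind
  have hσx : σ x ≠ y := fun h => hxx' (σ.injective (h.trans hσ.symm))
  have other_rows : ∀ i, i ≠ x' → ∀ j, (i, j) ∈ M := by
    intro i hi j
    by_cases hiR : i ∈ R
    · exact rows i hiR j
    refine force (i, σ x) (cols i x hx) ((Rᶜ.erase x').image fun j => (i, σ j)) ?_
      (Finset.card_image_le.trans hD.le) ((mem_nbhd _ _ _ _).2 (by grind))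
    rintro ⟨i', j'⟩ ⟨hN, hnM⟩
    obtain ⟨j', rfl⟩ := σ.surjective j'
    rw [mem_nbhd] at hN
    have := cols i' j'
    have := cols i' x hx
    have := column_y i'
    simp only [Finset.coe_image, Set.mem_image, Finset.mem_coe, Finset.mem_erase,
      Finset.mem_compl, Prod.mk.injEq]
    grind
  have row_x' : ∀ j, j ≠ y → (x', j) ∈ M := by
    intro j hj
    refine force (x, j) (rows x hx j) {(x', j)} ?_ hk
      ((mem_nbhd _ _ _ _).2 (by grind))
    rintro ⟨i', j'⟩ ⟨hN, hnM⟩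
    rw [mem_nbhd] at hN
    have := other_rows i'
    have := other_rows x hxx' j'
    simp only [Finset.coe_singleton, Set.mem_singleton_iff, Prod.mk.injEq]
    grind
  have last : (x', y) ∈ M := by
    refine force (x', σ x) (cols x' x hx) {(x', y)} ?_ hk
      ((mem_nbhd _ _ _ _).2 (by grind))
    rintro ⟨i', j'⟩ ⟨hN, hnM⟩
    have := other_rows i'
    have := row_x' j'
    simp only [Finset.coe_singleton, Set.mem_singleton_iff, Prod.mk.injEq]
    grind
  ext ⟨i, j⟩
  have := other_rows i
  have := row_x' j
  grind

theorem exists_isPDS_boxProd_top_deleteEdges_left {a : ℕ} (hk : 0 < k) (ha : k + 2 ≤ a)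
    {x x' : Fin a} (y : Fin a) (h : x ≠ x') :
    ∃ S, IsPDS (((⊤ : SimpleGraph (Fin a)) □ (⊤ : SimpleGraph (Fin a))).deleteEdges
      {s((x, y), (x', y))}) k S ∧ S.ncard = a - k - 1 := by
  obtain ⟨R, hxR, hRx', hR⟩ := Finset.exists_subsuperset_card_eq (s := {x}) (t := {x'}ᶜ)
    (n := a - k - 1) (by simpa using h.symm) (by rw [Finset.card_singleton]; omega)
    (by rw [Finset.card_compl, Finset.card_singleton, Fintype.card_fin]; omega)
  have hx' : x' ∉ R := fun hmem => by simpa using hRx' hmem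
  refine ⟨_, isPDS_graph_boxProd_top_deleteEdges hk (Equiv.swap x' y) (by simpa using hxR) hx'
    (Equiv.swap_apply_left x' y) (by rw [Fintype.card_fin]; omega), ?_⟩
  rw [Set.ncard_image_of_injective _ fun i j hij => congrArg Prod.fst hij,
    Set.ncard_coe_finset, hR]

/-- Swapping the two factors, after deleting corresponding edges. -/
def boxProdTopDeleteEdgesComm (p q : α × β) :
    ((⊤ : SimpleGraph α) □ (⊤ : SimpleGraph β)).deleteEdges {s(p, q)} ≃g
      ((⊤ : SimpleGraph β) □ (⊤ : SimpleGraph α)).deleteEdges {s(p.swap, q.swap)} where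
  toEquiv := Equiv.prodComm α β
  map_rel_iff' := by
    rintro ⟨i, j⟩ ⟨i', j'⟩
    simp [boxProd_adj, Prod.ext_iff, or_comm, and_comm]

theorem exists_isPDS_boxProd_top_deleteEdges {a : ℕ} (hk : 0 < k) (ha : k + 2 ≤ a)
    (e : Sym2 (Fin a × Fin a))
    (he : e ∈ ((⊤ : SimpleGraph (Fin a)) □ (⊤ : SimpleGraph (Fin a))).edgeSet) :
    ∃ S, IsPDS (((⊤ : SimpleGraph (Fin a)) □ (⊤ : SimpleGraph (Fin a))).deleteEdges {e}) k S ∧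
      S.ncard = a - k - 1 := by
  induction e with | _ p q => ?_
  obtain ⟨x, y⟩ := p
  obtain ⟨x', y'⟩ := q
  simp only [mem_edgeSet, boxProd_adj, top_adj] at he
  obtain ⟨hne, rfl⟩ | ⟨hne, rfl⟩ := he
  · exact exists_isPDS_boxProd_top_deleteEdges_left hk ha y hne
  · obtain ⟨S, hS, hcard⟩ := exists_isPDS_boxProd_top_deleteEdges_left hk ha x hne
    let f := boxProdTopDeleteEdgesComm (y, x) (y', x)
    exact ⟨f '' S, hS.image_iso f, by rw [Set.ncard_image_of_injective _ f.injective, hcard]⟩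

end RookGraph

theorem pdn_boxProd_complete_edge_deletion (k a : ℕ) (hk : 0 < k) (ha : k + 2 ≤ a)
    (e : Sym2 (Fin a × Fin a))
    (he : e ∈ ((⊤ : SimpleGraph (Fin a)) □ (⊤ : SimpleGraph (Fin a))).edgeSet) :
    pdn (((⊤ : SimpleGraph (Fin a)) □ (⊤ : SimpleGraph (Fin a))).deleteEdges {e}) k =
      a - k - 1 := by
  have hex := exists_isPDS_boxProd_top_deleteEdges hk ha e he
  refine le_antisymm (Nat.sInf_le hex) (le_csInf ⟨_, hex⟩ ?_)
  rintro _ ⟨S, hS, rfl⟩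
  exact hS.le_ncard_boxProd_top_deleteEdges ha e
end
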